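/- arXiv:1606.07395 — 2 statements merged into one kernel-verified Lean document; each statement's English description precedes it below -/
import Mathlib

section
/- Fix lattice polytopes W, P₁, …, P_r in ℝⁿ. Then the set of r-tuples (Y₁,…,Y_r) of lattice polytopes satisfying W = convexHull ℝ (⋃_{i=1}^r (P_i + Y_i)) is a finite set. -/
open Pointwise

/-- A lattice polytope in `ℝⁿ`: the convex hull of a nonempty finite set of points
all of whose coordinates are nonnegative integers. -/
def IsLatticePolytope {n : ℕ} (P : Set (Fin n → ℝ)) : Prop :=
  ∃ F : Finset (Fin n → ℝ), F.Nonempty ∧ (∀ x ∈ F, ∀ i, ∃ m : ℕ, x i = (m : ℝ)) ∧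
    P = convexHull ℝ (F : Set (Fin n → ℝ))

theorem IsLatticePolytope.nonempty {n : ℕ} {P : Set (Fin n → ℝ)} (hP : IsLatticePolytope P) :
    P.Nonempty := by
  obtain ⟨F, hF, -, rfl⟩ := hP
  exact Set.Nonempty.convexHull (Finset.coe_nonempty.2 hF)

theorem IsLatticePolytope.nonneg {n : ℕ} {P : Set (Fin n → ℝ)} (hP : IsLatticePolytope P)
    {x : Fin n → ℝ} (hx : x ∈ P) : 0 ≤ x := by
  obtain ⟨F, -, hF, rfl⟩ := hP
  refine convexHull_min (t := Set.Ici 0) (fun y hy j => ?_) (convex_Ici 0) hx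
  obtain ⟨m, hm⟩ := hF y hy j
  simp [hm]

theorem IsLatticePolytope.bddAbove {n : ℕ} {P : Set (Fin n → ℝ)} (hP : IsLatticePolytope P) :
    BddAbove P := by
  obtain ⟨F, -, -, rfl⟩ := hP
  obtain ⟨b, hb⟩ := F.bddAbove
  exact ⟨b, convexHull_min (t := Set.Iic b) (fun _ hy => hb hy) (convex_Iic b)⟩

theorem finite_lattice_points_le {n : ℕ} (b : Fin n → ℝ) :
    {x : Fin n → ℝ | (∀ j, ∃ m : ℕ, x j = (m : ℝ)) ∧ x ≤ b}.Finite := by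
  refine (Set.Finite.pi' fun j => ((Set.finite_Iic ⌊b j⌋₊).image (Nat.cast : ℕ → ℝ))).subset ?_
  rintro x ⟨hx, hxb⟩ j
  obtain ⟨m, hm⟩ := hx j
  exact ⟨m, Nat.le_floor (hm ▸ hxb j), hm.symm⟩

/-- Only finitely many lattice polytopes lie below a given point. -/
theorem finite_isLatticePolytope_subset_Iic {n : ℕ} (b : Fin n → ℝ) :
    {Q : Set (Fin n → ℝ) | IsLatticePolytope Q ∧ Q ⊆ Set.Iic b}.Finite := by
  refine ((finite_lattice_points_le b).finite_subsets.image (convexHull ℝ)).subset ?_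
  rintro _ ⟨⟨F, -, hF, rfl⟩, hQ⟩
  exact ⟨F, fun x hx => ⟨hF x hx, hQ (subset_convexHull ℝ _ hx)⟩, rfl⟩

/-- The set of tuples of lattice polytopes `(Y₁, …, Y_r)` with
`W = ⊕ᵢ (Pᵢ ⊙ Yᵢ)` is finite. -/
theorem solutions_finite {n r : ℕ} (W : Set (Fin n → ℝ)) (P : Fin r → Set (Fin n → ℝ))
    (hW : IsLatticePolytope W) (hP : ∀ i, IsLatticePolytope (P i)) :
    Set.Finite {Y : Fin r → Set (Fin n → ℝ) |
      (∀ i, IsLatticePolytope (Y i)) ∧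
      W = convexHull ℝ (⋃ i, (P i + Y i))} := by
  obtain ⟨b, hb⟩ := hW.bddAbove
  refine (Set.Finite.pi' fun _ : Fin r => finite_isLatticePolytope_subset_Iic b).subset ?_
  rintro Y ⟨hY, hWY⟩ i
  refine ⟨hY i, fun y hy => ?_⟩
  obtain ⟨p, hp⟩ := (hP i).nonempty
  have hpy : p + y ∈ W := by
    rw [hWY]
    exact subset_convexHull ℝ _ (Set.mem_iUnion.2 ⟨i, Set.add_mem_add hp hy⟩)
  exact (le_add_of_nonneg_left ((hP i).nonneg hp)).trans (hb hpy)
end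

section
/- Let K be a field, r ≥ 2, and let f₁,…,f_r, g₁,…,g_r be nonzero polynomials in K[x₁,…,xₙ] with g₁·f₁ + g₂·f₂ + ⋯ + g_r·f_r = 0. Then every extreme point of W := convexHull ℝ (⋃_{i=1}^r (New(f_i) + New(g_i))) lies in New(f_i) + New(g_i) for at least two indices i. That is, (New(g₁),…,New(g_r)) is a polytope syzygy of (New(f₁),…,New(f_r)). -/
open Pointwise

/-- The Newton polytope of a multivariate polynomial. -/
noncomputable def newton {K : Type*} [CommSemiring K] {n : ℕ}
    (f : MvPolynomial (Fin n) K) : Set (Fin n → ℝ) :=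
  convexHull ℝ ((fun d : Fin n →₀ ℕ => fun i : Fin n => (d i : ℝ)) '' ↑f.support)

/-- An exponent vector, viewed as a point of `ℝⁿ`. -/
def exponentPoint {n : ℕ} (d : Fin n →₀ ℕ) : Fin n → ℝ := fun i => (d i : ℝ)

lemma exponentPoint_add {n : ℕ} (a b : Fin n →₀ ℕ) :
    exponentPoint (a + b) = exponentPoint a + exponentPoint b := by
  ext i
  simp [exponentPoint]

lemma exponentPoint_injective {n : ℕ} :
    Function.Injective (exponentPoint : (Fin n →₀ ℕ) → Fin n → ℝ) := by
  intro a b h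
  ext i
  exact Nat.cast_injective (R := ℝ) (congrFun h i)

lemma exponentPoint_mem_newton {K : Type*} [CommSemiring K] {n : ℕ}
    {f : MvPolynomial (Fin n) K} {d : Fin n →₀ ℕ} (hd : d ∈ f.support) :
    exponentPoint d ∈ newton f :=
  subset_convexHull ℝ _ ⟨d, hd, rfl⟩

lemma exponentPoint_add_mem {K : Type*} [CommSemiring K] {n : ℕ}
    {f g : MvPolynomial (Fin n) K} {a b : Fin n →₀ ℕ}
    (ha : a ∈ f.support) (hb : b ∈ g.support) :
    exponentPoint (a + b) ∈ newton f + newton g := by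
  rw [exponentPoint_add]
  exact Set.add_mem_add (exponentPoint_mem_newton ha) (exponentPoint_mem_newton hb)

/-- An extreme point of a set that contains `New(f) + New(g)` and is an exponent vector of the
form `a + b` is attained by a single pair of monomials of `f` and `g`. -/
lemma eq_of_add_eq_add_of_mem_extremePoints {K : Type*} [CommSemiring K] {n : ℕ}
    {f g : MvPolynomial (Fin n) K} {W : Set (Fin n → ℝ)} (hW : newton f + newton g ⊆ W)
    {a b a' b' : Fin n →₀ ℕ} (ha : a ∈ f.support) (hb : b ∈ g.support)
    (ha' : a' ∈ f.support) (hb' : b' ∈ g.support) (h : a' + b' = a + b)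
    (hv : exponentPoint (a + b) ∈ W.extremePoints ℝ) : b' = b := by
  have hmid : exponentPoint (a + b) ∈
      openSegment ℝ (exponentPoint (a + b')) (exponentPoint (a' + b)) := by
    refine ⟨1 / 2, 1 / 2, by norm_num, by norm_num, by norm_num, ?_⟩
    rw [← smul_add, ← exponentPoint_add,
      show a + b' + (a' + b) = a + b + (a + b) by
        nth_rw 2 [← h]
        abel,
      exponentPoint_add (a + b), ← two_smul ℝ, smul_smul]
    norm_num
  have := hv.2 (hW (exponentPoint_add_mem ha hb')) (hW (exponentPoint_add_mem ha' hb)) hmid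
  exact add_left_cancel (exponentPoint_injective this)

lemma coeff_mul_of_mem_extremePoints {K : Type*} [CommSemiring K] {n : ℕ}
    {f g : MvPolynomial (Fin n) K} {W : Set (Fin n → ℝ)} (hW : newton f + newton g ⊆ W)
    {a b : Fin n →₀ ℕ} (ha : a ∈ f.support) (hb : b ∈ g.support)
    (hv : exponentPoint (a + b) ∈ W.extremePoints ℝ) :
    (g * f).coeff (a + b) = g.coeff b * f.coeff a := by
  classical
  rw [MvPolynomial.coeff_mul, Finset.sum_eq_single (b, a)]
  · rintro ⟨b', a'⟩ hp hne
    rw [Finset.HasAntidiagonal.mem_antidiagonal] at hp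
    by_contra hc
    have hb' : b' ∈ g.support := MvPolynomial.mem_support_iff.2 (left_ne_zero_of_mul hc)
    have ha' : a' ∈ f.support := MvPolynomial.mem_support_iff.2 (right_ne_zero_of_mul hc)
    have hbb : b' = b := eq_of_add_eq_add_of_mem_extremePoints hW ha hb ha' hb'
      ((add_comm a' b').trans hp) hv
    subst hbb
    exact hne (Prod.ext rfl (add_left_cancel (hp.trans (add_comm a b'))))
  · intro hp
    exact absurd (Finset.HasAntidiagonal.mem_antidiagonal.2 (add_comm b a)) hp

lemma exists_support_of_mem_extremePoints {K : Type*} [CommSemiring K] {n : ℕ} {ι : Type*}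
    {f g : ι → MvPolynomial (Fin n) K} {v : Fin n → ℝ}
    (hv : v ∈ (convexHull ℝ (⋃ i, (newton (f i) + newton (g i)))).extremePoints ℝ) :
    ∃ i, ∃ a ∈ (f i).support, ∃ b ∈ (g i).support, exponentPoint (a + b) = v := by
  obtain ⟨i, hi⟩ := Set.mem_iUnion.1 (extremePoints_convexHull_subset hv)
  have hsub : newton (f i) + newton (g i) ⊆ convexHull ℝ (⋃ i, (newton (f i) + newton (g i))) :=
    (Set.subset_iUnion (fun i => newton (f i) + newton (g i)) i).trans (subset_convexHull ℝ _)
  have hv' := inter_extremePoints_subset_extremePoints_of_subset hsub ⟨hi, hv⟩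
  rw [newton, newton, ← convexHull_add] at hv'
  obtain ⟨_, ⟨a, ha, rfl⟩, _, ⟨b, hb, rfl⟩, rfl⟩ := extremePoints_convexHull_subset hv'
  exact ⟨i, a, ha, b, hb, exponentPoint_add a b⟩

/-- A syzygy of polynomials specializes to a polytope syzygy of their Newton polytopes:
every extreme point of `W = ⊕ᵢ (New(fᵢ) ⊙ New(gᵢ))` lies in `New(fᵢ) + New(gᵢ)` for at
least two indices `i`. -/
theorem polynomial_syzygy_gives_polytope_syzygy {K : Type*} [Field K] {n r : ℕ}
    (hr : 2 ≤ r) (f g : Fin r → MvPolynomial (Fin n) K)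
    (hf : ∀ i, f i ≠ 0) (hg : ∀ i, g i ≠ 0)
    (hsyz : ∑ i, g i * f i = 0) :
    ∀ v ∈ Set.extremePoints ℝ (convexHull ℝ (⋃ i, (newton (f i) + newton (g i)))),
      ∃ i j : Fin r, i ≠ j ∧
        v ∈ newton (f i) + newton (g i) ∧ v ∈ newton (f j) + newton (g j) := by
  intro v hv
  obtain ⟨i, a, ha, b, hb, rfl⟩ := exists_support_of_mem_extremePoints hv
  have hsub : newton (f i) + newton (g i) ⊆ convexHull ℝ (⋃ i, (newton (f i) + newton (g i))) :=
    (Set.subset_iUnion (fun i => newton (f i) + newton (g i)) i).trans (subset_convexHull ℝ _)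
  have hi : (g i * f i).coeff (a + b) ≠ 0 := by
    rw [coeff_mul_of_mem_extremePoints hsub ha hb hv]
    exact mul_ne_zero (MvPolynomial.mem_support_iff.1 hb) (MvPolynomial.mem_support_iff.1 ha)
  have hsum : ∑ j, (g j * f j).coeff (a + b) = 0 := by
    rw [← MvPolynomial.coeff_sum, hsyz, MvPolynomial.coeff_zero]
  obtain ⟨j, hji, hj⟩ : ∃ j, j ≠ i ∧ (g j * f j).coeff (a + b) ≠ 0 := by
    by_contra! h
    exact hi ((Finset.sum_eq_single i (fun j _ => h j) (by simp)).symm.trans hsum)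
  refine ⟨i, j, hji.symm, exponentPoint_add_mem ha hb, ?_⟩
  rw [MvPolynomial.coeff_mul] at hj
  obtain ⟨⟨d, c⟩, hp, hdc⟩ := Finset.exists_ne_zero_of_sum_ne_zero hj
  rw [← Finset.HasAntidiagonal.mem_antidiagonal.1 hp, add_comm d c]
  exact exponentPoint_add_mem (MvPolynomial.mem_support_iff.2 (right_ne_zero_of_mul hdc))
    (MvPolynomial.mem_support_iff.2 (left_ne_zero_of_mul hdc))
end
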